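/- For n ≥ 4, the cardinality of ORD_n equals 2^n − (n³ + 11n)/6 + Σ_{m=1}^{n} C_m, where C_m = (1/(m+1))·C(2m, m) is the m-th Catalan number. -/

import Mathlib

open Finset

namespace ORDPaper

/-- `f` is a full transformation of the chain `{1,…,n}`, acting as the identity outside. -/
def IsTrans (n : ℕ) (f : ℕ → ℕ) : Prop :=
  (∀ x, 1 ≤ x → x ≤ n → 1 ≤ f x ∧ f x ≤ n) ∧ ∀ x, ¬(1 ≤ x ∧ x ≤ n) → f x = x

/-- Composition of transformations, written left to right: `x(αβ) = (xα)β`. -/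
def comp (f g : ℕ → ℕ) : ℕ → ℕ := fun x => g (f x)

/-- The value of `f` at the cyclic successor of `i` (so `(n+1)α = 1α`). -/
def nxt (n : ℕ) (f : ℕ → ℕ) (i : ℕ) : ℕ := if i = n then f 1 else f (i + 1)

/-- `(1α,…,nα)` is cyclic: there is at most one descent (cyclically). -/
def Cyclic (n : ℕ) (f : ℕ → ℕ) : Prop :=
  ((Finset.Icc 1 n).filter (fun i => nxt n f i < f i)).card ≤ 1

/-- `(1α,…,nα)` is anti-cyclic: there is at most one ascent (cyclically). -/
def AntiCyclic (n : ℕ) (f : ℕ → ℕ) : Prop :=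
  ((Finset.Icc 1 n).filter (fun i => f i < nxt n f i)).card ≤ 1

/-- Order-decreasing on `{1,…,n}`. -/
def Decreasing (n : ℕ) (f : ℕ → ℕ) : Prop := ∀ x, 1 ≤ x → x ≤ n → f x ≤ x

/-- Image of `{1,…,n}` under `f`. -/
def im (n : ℕ) (f : ℕ → ℕ) : Finset ℕ := (Finset.Icc 1 n).image f

/-- Fixed points of `f` in `{1,…,n}`. -/
def fixSet (n : ℕ) (f : ℕ → ℕ) : Finset ℕ := (Finset.Icc 1 n).filter (fun x => f x = x)

/-- The semigroup `D_n` of order-decreasing full transformations. -/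
def Dn (n : ℕ) : Set (ℕ → ℕ) := {f | IsTrans n f ∧ Decreasing n f}

/-- Orientation-preserving order-decreasing transformations. -/
def OPD (n : ℕ) : Set (ℕ → ℕ) := {f | f ∈ Dn n ∧ Cyclic n f}

/-- Oriented order-decreasing transformations. -/
def ORDn (n : ℕ) : Set (ℕ → ℕ) := {f | f ∈ Dn n ∧ (Cyclic n f ∨ AntiCyclic n f)}

/-- `RD*_n`: orientation-reversing, order-decreasing, not orientation-preserving. -/
def RDstar (n : ℕ) : Set (ℕ → ℕ) := {f | f ∈ Dn n ∧ AntiCyclic n f ∧ ¬ Cyclic n f}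

/-- `ORD(n,r)`. -/
def ORDr (n r : ℕ) : Set (ℕ → ℕ) := {f | f ∈ ORDn n ∧ (im n f).card ≤ r}

/-- `OPD(n,r)`. -/
def OPDr (n r : ℕ) : Set (ℕ → ℕ) := {f | f ∈ OPD n ∧ (im n f).card ≤ r}

/-- The order-reversing degree: `min(X_n \ 1α⁻¹)`. -/
noncomputable def ordDeg (n : ℕ) (f : ℕ → ℕ) : ℕ := sInf {x | 1 ≤ x ∧ x ≤ n ∧ f x ≠ 1}

/-- Minimum of the preimage of `x` under `f` inside `{1,…,n}`. -/
noncomputable def preMin (n : ℕ) (f : ℕ → ℕ) (x : ℕ) : ℕ := sInf {y | 1 ≤ y ∧ y ≤ n ∧ f y = x}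

/-- Membership in the subsemigroup generated by `A`. -/
inductive gen (A : Set (ℕ → ℕ)) : (ℕ → ℕ) → Prop
  | base {f} : f ∈ A → gen A f
  | mul {f g} : gen A f → gen A g → gen A (comp f g)

/-- Rank of a transformation semigroup `S`. -/
noncomputable def rank (S : Set (ℕ → ℕ)) : ℕ :=
  sInf {k | ∃ A : Set (ℕ → ℕ), A ⊆ S ∧ A.Finite ∧ A.ncard = k ∧ {f | gen A f} = S}

/-- `r̂ = min{r, ⌈(n+1)/2⌉}`. -/
def rhat (n r : ℕ) : ℕ := min r ((n + 2) / 2)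

/-- `ρ_m` fixes `1,…,m` and sends `m+1,…,n` to `1`. -/
def rho (n m : ℕ) : ℕ → ℕ := fun x =>
  if ¬(1 ≤ x ∧ x ≤ n) then x else if x ≤ m then x else 1

/-- The order-preserving degree `opd(α) = max{m : α|_{X_m} is order-preserving}`. -/
noncomputable def opd (n : ℕ) (f : ℕ → ℕ) : ℕ :=
  sSup {m | m ≤ n ∧ ∀ x y, 1 ≤ x → x ≤ y → y ≤ m → f x ≤ f y}

/-- The set `C = (⋃_{m=r+1}^n B_m) ∪ {ρ_2,…,ρ_r}`. -/
def Cset (n r : ℕ) : Set (ℕ → ℕ) :=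
  {f | (f ∈ OPD n ∧ comp f f = f ∧ (im n f).card = r ∧ r + 1 ≤ opd n f ∧ opd n f ≤ n)
    ∨ (∃ m, 2 ≤ m ∧ m ≤ r ∧ f = rho n m)}

/-- The map `λ_{m,r}`: sends `[1,m-1]` to `1`, maps `x ∈ [m, min(2m-p-2,n)]` to `2m-x`
(where `p = max{0, m-r}` is `m - r` in truncated subtraction), and the rest of `[1,n]` to `1`. -/
def lam (n r m : ℕ) : ℕ → ℕ := fun x =>
  if ¬(1 ≤ x ∧ x ≤ n) then x
  else if x < m then 1
  else if x ≤ min (2 * m - (m - r) - 2) n then 2 * m - x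
  else 1

/-- `G_{n,r} = {λ_{m,r} : 3 ≤ m ≤ n-1}`. -/
def Gset (n r : ℕ) : Set (ℕ → ℕ) := {f | ∃ m, 3 ≤ m ∧ m ≤ n - 1 ∧ f = lam n r m}

/-- `L_{m,r}`. -/
def Lset (n r m : ℕ) : Set (ℕ → ℕ) :=
  {f | f ∈ ORDn n ∧ im n f = im n (lam n r m) ∧
    ∀ x ∈ im n (lam n r m), preMin n f x = preMin n (lam n r m) x}

/-- `α_{m,r}`: the idempotent fixing `{1} ∪ [m, 2m-p-2]` and sending the rest of `[1,n]` to `1`. -/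
def alphaMap (n r m : ℕ) : ℕ → ℕ := fun x =>
  if ¬(1 ≤ x ∧ x ≤ n) then x
  else if x < m then 1
  else if x ≤ 2 * m - (m - r) - 2 then x
  else 1

/-- `β_{m,r}`: sends `[1,m-1]` to `1`, maps `m,…,2m-p-3` order-reversingly to `m,…,p+3`,
and `[2m-p-2, n]` to `p+2`. -/
def betaMap (n r m : ℕ) : ℕ → ℕ := fun x =>
  if ¬(1 ≤ x ∧ x ≤ n) then x
  else if x < m then 1
  else if x ≤ 2 * m - (m - r) - 3 then 2 * m - x
  else (m - r) + 2

/-- `S` is a subsemigroup of `T`. -/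
def IsSubsemigroupOf (S T : Set (ℕ → ℕ)) : Prop :=
  S ⊆ T ∧ ∀ f ∈ S, ∀ g ∈ S, comp f g ∈ S

/-- `S` is a maximal subsemigroup of `T`. -/
def IsMaximalSubsemigroupOf (S T : Set (ℕ → ℕ)) : Prop :=
  IsSubsemigroupOf S T ∧ S ≠ T ∧ ∀ U, IsSubsemigroupOf U T → S ⊆ U → U = S ∨ U = T

/-- Locally increasing on `[1,n]`. -/
def MonoP (n : ℕ) (f : ℕ → ℕ) : Prop := ∀ x, 1 ≤ x → x < n → f x ≤ f (x + 1)

/-- Working form of `Cyclic`. -/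
def CycP (n : ℕ) (f : ℕ → ℕ) : Prop :=
  ∀ x y, 1 ≤ x → x < y → y ≤ n → f (x + 1) < f x → f y = 1

/-- Working form of `AntiCyclic`. -/
def AntiP (n : ℕ) (f : ℕ → ℕ) : Prop :=
  ∀ x y, 1 ≤ x → x ≤ y → y < n → 1 < f x → f (y + 1) ≤ f y

/-- Nonconstant. -/
def NC (n : ℕ) (f : ℕ → ℕ) : Prop := ∃ x, 1 ≤ x ∧ x ≤ n ∧ 1 < f x

/-- Number of members of `D_n` satisfying `P`. -/
noncomputable def cnt (n : ℕ) (P : (ℕ → ℕ) → Prop) : ℕ := {f | f ∈ Dn n ∧ P f}.ncard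

theorem Dn_pos {n : ℕ} {f : ℕ → ℕ} (hf : f ∈ Dn n) {x : ℕ} (h1 : 1 ≤ x) : 1 ≤ f x := by
  by_cases h : x ≤ n
  · exact (hf.1.1 x h1 h).1
  · rw [hf.1.2 x (by omega)]; exact h1

theorem Dn_le {n : ℕ} {f : ℕ → ℕ} (hf : f ∈ Dn n) (x : ℕ) : f x ≤ x := by
  by_cases h : 1 ≤ x ∧ x ≤ n
  · exact hf.2 x h.1 h.2
  · rw [hf.1.2 x h]

theorem Dn_one {n : ℕ} {f : ℕ → ℕ} (hf : f ∈ Dn n) : f 1 = 1 :=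
  le_antisymm (Dn_le hf 1) (Dn_pos hf le_rfl)

theorem mem_Dn {n : ℕ} {f : ℕ → ℕ} :
    f ∈ Dn n ↔ (∀ x, 1 ≤ x → 1 ≤ f x) ∧ (∀ x, f x ≤ x) ∧ ∀ x, n < x → f x = x := by
  constructor
  · intro hf
    exact ⟨fun x => Dn_pos hf, Dn_le hf, fun x hx => hf.1.2 x (by omega)⟩
  · rintro ⟨h1, h2, h3⟩
    refine ⟨⟨fun x hx hn => ⟨h1 x hx, (h2 x).trans hn⟩, fun x hx => ?_⟩, fun x _ _ => h2 x⟩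
    by_cases h : n < x
    · exact h3 x h
    · have : x = 0 := by omega
      subst this
      exact Nat.le_zero.1 (h2 0)

theorem Dn_finite (n : ℕ) : (Dn n).Finite := by
  apply Set.Finite.of_finite_image (f := fun f => fun i : Fin (n + 1) => f i)
  · apply Set.Finite.subset (Set.finite_Iic (fun _ : Fin (n + 1) => n))
    rintro _ ⟨f, hf, rfl⟩ i
    have := Dn_le hf i
    have := i.2
    simp only
    omega
  · intro f hf g hg h
    funext x
    by_cases hx : x ≤ n
    · exact congrFun h ⟨x, by omega⟩
    · rw [(mem_Dn.1 hf).2.2 x (by omega), (mem_Dn.1 hg).2.2 x (by omega)]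

theorem cnt_congr {n : ℕ} {P Q : (ℕ → ℕ) → Prop} (h : ∀ f ∈ Dn n, (P f ↔ Q f)) :
    cnt n P = cnt n Q := by
  unfold cnt
  congr 1
  ext f
  exact and_congr_right (h f)

theorem cnt_split (n : ℕ) (P Q : (ℕ → ℕ) → Prop) :
    cnt n P = cnt n (fun f => P f ∧ Q f) + cnt n (fun f => P f ∧ ¬ Q f) := by
  unfold cnt
  rw [← Set.ncard_union_eq ?_ ((Dn_finite n).subset fun f hf => hf.1)
    ((Dn_finite n).subset fun f hf => hf.1)]
  · congr 1
    ext f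
    simp only [Set.mem_ofPred_eq, Set.mem_union]
    tauto
  · rw [Set.disjoint_left]
    rintro f ⟨_, _, h⟩ ⟨_, _, hh⟩
    exact hh h

/-- Split according to a case distinction. -/
theorem cnt_add {n : ℕ} {P Q R : (ℕ → ℕ) → Prop} (h : ∀ f ∈ Dn n, (P f ↔ Q f ∨ R f))
    (h' : ∀ f ∈ Dn n, Q f → ¬ R f) : cnt n P = cnt n Q + cnt n R := by
  rw [cnt_split n P Q]
  congr 1 <;> apply cnt_congr <;> intro f hf <;> have := h f hf <;> have := h' f hf <;> tauto

theorem cnt_zero {n : ℕ} {P : (ℕ → ℕ) → Prop} (h : ∀ f ∈ Dn n, ¬ P f) : cnt n P = 0 := by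
  unfold cnt
  convert Set.ncard_empty (ℕ → ℕ)
  ext f
  simp only [Set.mem_ofPred_eq, Set.mem_empty_iff_false, iff_false]
  tauto

theorem upd_le {n : ℕ} (g : ℕ → ℕ) (j : ℕ) {x : ℕ} (hx : x ≤ n) :
    Function.update g (n + 1) j x = g x := Function.update_of_ne (by omega) _ _

theorem upd_self {n : ℕ} (g : ℕ → ℕ) (j : ℕ) :
    Function.update g (n + 1) j (n + 1) = j := Function.update_self _ _ _

theorem cnt_succ {n j : ℕ} (h1 : 1 ≤ j) (hj : j ≤ n + 1) (P : (ℕ → ℕ) → Prop) :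
    cnt (n + 1) (fun f => f (n + 1) = j ∧ P f) =
      cnt n (fun g => P (Function.update g (n + 1) j)) := by
  unfold cnt
  symm
  apply Set.ncard_congr (fun g _ => Function.update g (n + 1) j)
  · rintro g ⟨hg, hP⟩
    refine ⟨?_, upd_self g j, hP⟩
    rw [mem_Dn] at hg ⊢
    obtain ⟨a, b, c⟩ := hg
    refine ⟨fun x hx => ?_, fun x => ?_, fun x hx => ?_⟩ <;> by_cases h : x = n + 1
    · subst h; rw [upd_self]; exact h1
    · rw [Function.update_of_ne h]; exact a x hx
    · subst h; rw [upd_self]; exact hj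
    · rw [Function.update_of_ne h]; exact b x
    · omega
    · rw [Function.update_of_ne h]; exact c x (by omega)
  · rintro f g ⟨hf, _⟩ ⟨hg, _⟩ h
    funext x
    by_cases hx : x = n + 1
    · rw [(mem_Dn.1 hf).2.2 x (by omega), (mem_Dn.1 hg).2.2 x (by omega)]
    · have := congrFun h x
      simpa [Function.update_of_ne hx] using this
  · rintro f ⟨hf, hfj, hP⟩
    have key : Function.update (Function.update f (n + 1) (n + 1)) (n + 1) j = f := by
      rw [Function.update_idem, ← hfj, Function.update_eq_self]
    refine ⟨Function.update f (n + 1) (n + 1), ⟨?_, by beta_reduce; rw [key]; exact hP⟩, key⟩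
    rw [mem_Dn] at hf ⊢
    obtain ⟨a, b, c⟩ := hf
    refine ⟨fun x hx => ?_, fun x => ?_, fun x hx => ?_⟩ <;> by_cases h : x = n + 1
    · subst h; rw [upd_self]; omega
    · rw [Function.update_of_ne h]; exact a x hx
    · subst h; rw [upd_self]
    · rw [Function.update_of_ne h]; exact b x
    · subst h; rw [upd_self]
    · rw [Function.update_of_ne h]; exact c x (by omega)

theorem mono_le {n : ℕ} {f : ℕ → ℕ} (h : MonoP n f) {x y : ℕ} (hx : 1 ≤ x) (hxy : x ≤ y)
    (hy : y ≤ n) : f x ≤ f y := by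
  induction y, hxy using Nat.le_induction with
  | base => exact le_rfl
  | succ y hxy ih => exact (ih (by omega)).trans (h y (by omega) (by omega))

/-! Behaviour under extension -/

theorem mono_upd {n j : ℕ} {g : ℕ → ℕ} (hg : g ∈ Dn n) :
    MonoP (n + 1) (Function.update g (n + 1) j) ↔ MonoP n g ∧ g n ≤ j := by
  constructor
  · intro h
    constructor
    · intro x h1 h2
      have := h x h1 (by omega)
      rwa [upd_le _ _ (by omega), upd_le _ _ (by omega)] at this
    · by_cases h0 : 1 ≤ n
      · have := h n h0 (by omega)
        rwa [upd_le _ _ (by omega), upd_self] at this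
      · have := Dn_le hg n
        omega
  · rintro ⟨h, h'⟩ x h1 h2
    rcases Nat.lt_succ_iff_lt_or_eq.1 h2 with h3 | rfl
    · rw [upd_le _ _ (by omega), upd_le _ _ (by omega)]; exact h x h1 h3
    · rw [upd_le _ _ (by omega), upd_self]; exact h'

theorem nc_upd {n j : ℕ} {g : ℕ → ℕ} :
    NC (n + 1) (Function.update g (n + 1) j) ↔ NC n g ∨ 1 < j := by
  constructor
  · rintro ⟨x, h1, h2, h3⟩
    rcases Nat.le_succ_iff.1 h2 with h4 | rfl
    · rw [upd_le _ _ h4] at h3; exact Or.inl ⟨x, h1, h4, h3⟩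
    · rw [upd_self] at h3; exact Or.inr h3
  · rintro (⟨x, h1, h2, h3⟩ | h)
    · exact ⟨x, h1, by omega, by rwa [upd_le _ _ h2]⟩
    · exact ⟨n + 1, by omega, le_rfl, by rwa [upd_self]⟩

theorem anti_upd {n j : ℕ} {g : ℕ → ℕ} :
    AntiP (n + 1) (Function.update g (n + 1) j) ↔ AntiP n g ∧ (NC n g → j ≤ g n) := by
  constructor
  · intro h
    constructor
    · intro x y h1 h2 h3 h4
      have := h x y h1 h2 (by omega)
      rw [upd_le _ _ (by omega), upd_le _ _ (by omega), upd_le _ _ (by omega)] at this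
      exact this h4
    · rintro ⟨x, h1, h2, h3⟩
      have := h x n h1 h2 (by omega)
      rw [upd_self, upd_le _ _ h2, upd_le _ _ le_rfl] at this
      exact this h3
  · rintro ⟨h, h'⟩ x y h1 h2 h3 h4
    rw [upd_le _ _ (by omega)] at h4
    rcases Nat.lt_succ_iff_lt_or_eq.1 h3 with h5 | rfl
    · rw [upd_le _ _ (by omega), upd_le _ _ (by omega)]; exact h x y h1 h2 h5 h4
    · rw [upd_self, upd_le _ _ le_rfl]; exact h' ⟨x, h1, h2, h4⟩

theorem cyc_upd_one {n : ℕ} {g : ℕ → ℕ} :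
    CycP (n + 1) (Function.update g (n + 1) 1) ↔ CycP n g := by
  constructor
  · intro h x y h1 h2 h3 h4
    have := h x y h1 h2 (by omega)
    rw [upd_le _ _ (by omega), upd_le _ _ (by omega), upd_le _ _ (by omega)] at this
    exact this h4
  · intro h x y h1 h2 h3 h4
    rcases Nat.le_succ_iff.1 h3 with h5 | rfl
    · rw [upd_le _ _ (by omega), upd_le _ _ (by omega)] at h4
      rw [upd_le _ _ (by omega)]
      exact h x y h1 h2 h5 h4
    · exact upd_self _ _

theorem cyc_mono {n : ℕ} {f : ℕ → ℕ} (h : 1 < f n) : CycP n f ↔ MonoP n f := by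
  constructor
  · intro hc x h1 h2
    by_contra h3
    have := hc x n h1 h2 le_rfl (by omega)
    omega
  · intro hm x y h1 h2 h3 h4
    have := hm x h1 (by omega)
    omega

theorem cyclic_iff {n : ℕ} (hn : 1 ≤ n) {f : ℕ → ℕ} (hf : f ∈ Dn n) :
    Cyclic n f ↔ CycP n f := by
  unfold Cyclic
  rw [Finset.card_le_one]
  simp only [Finset.mem_filter, Finset.mem_Icc]
  have f1 := Dn_one hf
  constructor
  · intro h x y h1 h2 h3 h4
    by_contra h5
    have h6 := Dn_pos hf (x := y) (by omega)
    -- a further descent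
    have : ∃ z, y ≤ z ∧ z ≤ n ∧ nxt n f z < f z := by
      by_contra hno
      push Not at hno
      have : ∀ z, y ≤ z → z ≤ n → f y ≤ f z := by
        intro z hz
        induction z, hz using Nat.le_induction with
        | base => intro _; exact le_rfl
        | succ z hz ih =>
          intro hz'
          have a := ih (by omega)
          have b := hno z hz (by omega)
          rw [nxt, if_neg (by omega)] at b
          omega
      have a := this n h3 le_rfl
      have b := hno n h3 le_rfl
      rw [nxt, if_pos rfl] at b
      omega
    obtain ⟨z, hz1, hz2, hz3⟩ := this
    have := h x ⟨⟨h1, by omega⟩, by rw [nxt, if_neg (by omega)]; exact h4⟩ z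
      ⟨⟨by omega, hz2⟩, hz3⟩
    omega
  · intro h
    have key : ∀ a b, 1 ≤ a → a < b → b ≤ n → nxt n f a < f a → nxt n f b < f b → False := by
      intro a b h1 h2 h3 h4 h5
      rw [nxt, if_neg (by omega)] at h4
      have := h a b h1 h2 h3 h4
      have : 1 ≤ nxt n f b := by
        unfold nxt
        split_ifs
        · omega
        · exact Dn_pos hf (by omega)
      omega
    rintro a ⟨⟨a1, a2⟩, a3⟩ b ⟨⟨b1, b2⟩, b3⟩
    rcases lt_trichotomy a b with hab | hab | hab
    · exact (key a b a1 hab b2 a3 b3).elim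
    · exact hab
    · exact (key b a b1 hab a2 b3 a3).elim

theorem anticyclic_iff {n : ℕ} (hn : 1 ≤ n) {f : ℕ → ℕ} (hf : f ∈ Dn n) :
    AntiCyclic n f ↔ AntiP n f := by
  unfold AntiCyclic
  rw [Finset.card_le_one]
  simp only [Finset.mem_filter, Finset.mem_Icc]
  have f1 := Dn_one hf
  constructor
  · intro h x y h1 h2 h3 h4
    by_contra h5
    have : ∃ z, 1 ≤ z ∧ z < x ∧ f z < f (z + 1) := by
      by_contra hno
      push Not at hno
      have : ∀ z, 1 ≤ z → z ≤ x → f z ≤ 1 := by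
        intro z hz
        induction z, hz using Nat.le_induction with
        | base => intro _; omega
        | succ z hz ih =>
          intro hz'
          have a := ih (by omega)
          have b := hno z hz (by omega)
          omega
      have := this x h1 le_rfl
      omega
    obtain ⟨z, hz1, hz2, hz3⟩ := this
    have := h z ⟨⟨hz1, by omega⟩, by rw [nxt, if_neg (by omega)]; exact hz3⟩ y
      ⟨⟨by omega, by omega⟩, by rw [nxt, if_neg (by omega)]; omega⟩
    omega
  · intro h
    have key : ∀ a b, 1 ≤ a → a < b → b ≤ n → f a < nxt n f a → f b < nxt n f b → False := by
      intro a b h1 h2 h3 h4 h5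
      rw [nxt, if_neg (by omega)] at h4
      have pa := Dn_pos hf h1
      have pb := Dn_pos hf (x := b) (by omega)
      by_cases hb : b = n
      · rw [nxt, if_pos hb] at h5
        omega
      · rw [nxt, if_neg hb] at h5
        have := h (a + 1) b (by omega) h2 (by omega) (by omega)
        omega
    rintro a ⟨⟨a1, a2⟩, a3⟩ b ⟨⟨b1, b2⟩, b3⟩
    rcases lt_trichotomy a b with hab | hab | hab
    · exact (key a b a1 hab b2 a3 b3).elim
    · exact hab
    · exact (key b a b1 hab a2 b3 a3).elim

/-! Counting -/

theorem cnt_true_zero {P : (ℕ → ℕ) → Prop} (h : P id) : cnt 0 P = 1 := by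
  unfold cnt
  rw [Set.ncard_eq_one]
  refine ⟨id, ?_⟩
  ext f
  simp only [Set.mem_ofPred_eq, Set.mem_singleton_iff]
  constructor
  · rintro ⟨hf, _⟩
    funext x
    exact hf.1.2 x (by omega)
  · rintro rfl
    exact ⟨mem_Dn.2 ⟨fun x hx => hx, fun x => le_rfl, fun x _ => rfl⟩, h⟩

theorem cnt_const (n : ℕ) : cnt n (fun f => ¬ NC n f) = 1 := by
  induction n with
  | zero => exact cnt_true_zero (by rintro ⟨x, h1, h2, _⟩; omega)
  | succ n ih =>
    refine Eq.trans ?_ ih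
    rw [cnt_congr (Q := fun f => f (n + 1) = 1 ∧ ¬ NC (n + 1) f), cnt_succ le_rfl (by omega)]
    · apply cnt_congr
      intro g _
      rw [nc_upd]
      simp
    · intro f hf
      refine ⟨fun h => ⟨?_, h⟩, fun h => h.2⟩
      have := Dn_pos hf (x := n + 1) (by omega)
      by_contra h'
      exact h ⟨n + 1, by omega, le_rfl, by omega⟩

theorem cnt_mono (n : ℕ) : ∀ k, k ≤ n →
    cnt n (fun f => MonoP n f ∧ f n ≤ k + 1) + (n + k).choose (n + 1) = (n + k).choose n := by
  induction n with
  | zero =>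
    intro k hk
    have : k = 0 := by omega
    subst this
    rw [cnt_true_zero]
    · simp
    · exact ⟨fun x h1 h2 => by omega, by simp⟩
  | succ n ih =>
    have step : ∀ k, k ≤ n → cnt (n + 1) (fun f => MonoP (n + 1) f ∧ f (n + 1) ≤ k + 1) =
        cnt (n + 1) (fun f => MonoP (n + 1) f ∧ f (n + 1) ≤ k) +
        cnt n (fun f => MonoP n f ∧ f n ≤ k + 1) := by
      intro k hk
      rw [cnt_add (Q := fun f => MonoP (n + 1) f ∧ f (n + 1) ≤ k)
        (R := fun f => f (n + 1) = k + 1 ∧ MonoP (n + 1) f), cnt_succ (by omega) (by omega)]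
      · congr 1
        apply cnt_congr
        intro g hg
        exact mono_upd hg
      · intro f _
        constructor
        · rintro ⟨h1, h2⟩
          by_cases h : f (n + 1) = k + 1
          · exact Or.inr ⟨h, h1⟩
          · exact Or.inl ⟨h1, by omega⟩
        · rintro (⟨h1, h2⟩ | ⟨h1, h2⟩)
          · exact ⟨h1, by omega⟩
          · exact ⟨h2, by omega⟩
      · rintro f _ ⟨_, h2⟩ ⟨h3, _⟩
        omega
    intro k
    induction k with
    | zero =>
      intro _
      rw [step 0 (by omega), cnt_zero]
      · have := ih 0 (by omega)
        simp at this ⊢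
        exact this
      · rintro f hf ⟨_, h⟩
        have := Dn_pos hf (x := n + 1) (by omega)
        omega
    | succ k ihk =>
      intro hk
      have e1 : (n + 1 + (k + 1)).choose (n + 1 + 1) =
        (n + (k + 1)).choose (n + 1) + (n + 1 + k).choose (n + 1 + 1) := by
        rw [show n + 1 + (k + 1) = (n + (k + 1)) + 1 by ring, Nat.choose_succ_succ,
          show n + (k + 1) = n + 1 + k by ring]
      have e2 : (n + 1 + (k + 1)).choose (n + 1) =
        (n + (k + 1)).choose n + (n + 1 + k).choose (n + 1) := by
        rw [show n + 1 + (k + 1) = (n + (k + 1)) + 1 by ring, Nat.choose_succ_succ,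
          show n + (k + 1) = n + 1 + k by ring]
      have e3 := ihk (by omega)
      rw [e1, e2]
      by_cases h : k + 1 ≤ n
      · rw [step (k + 1) h]
        have := ih (k + 1) h
        omega
      · have hkn : k = n := by omega
        subst hkn
        have e4 : cnt (k + 1) (fun f => MonoP (k + 1) f ∧ f (k + 1) ≤ k + 1 + 1) =
            cnt (k + 1) (fun f => MonoP (k + 1) f ∧ f (k + 1) ≤ k + 1) := by
          apply cnt_congr
          intro f hf
          have := Dn_le hf (k + 1)
          constructor
          · rintro ⟨a, _⟩; exact ⟨a, this⟩
          · rintro ⟨a, _⟩; exact ⟨a, by omega⟩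
        rw [e4]
        have e5 : (k + (k + 1)).choose (k + 1) = (k + (k + 1)).choose k :=
          Nat.choose_symm_of_eq_add (by omega)
        rw [show k + 1 + k = k + (k + 1) by ring] at *
        omega

theorem cnt_mono_all (n : ℕ) : cnt n (MonoP n) = catalan n := by
  have h := cnt_mono n n le_rfl
  have e : cnt n (fun f => MonoP n f ∧ f n ≤ n + 1) = cnt n (MonoP n) := by
    apply cnt_congr
    intro f hf
    have := Dn_le hf n
    constructor
    · exact fun h => h.1
    · exact fun h => ⟨h, by omega⟩
  rw [e] at h
  have h1 := Nat.succ_mul_centralBinom_succ n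
  have h2 := succ_mul_catalan_eq_centralBinom n
  have h3 := Nat.choose_succ_right_eq (2 * n) n
  rw [← two_mul] at h
  rw [← Nat.centralBinom_eq_two_mul_choose] at h h3
  rw [show 2 * n - n = n by omega] at h3
  have : (n + 1) * cnt n (MonoP n) = (n + 1) * catalan n := by
    rw [h2]
    nlinarith
  exact Nat.eq_of_mul_eq_mul_left (by omega) this

theorem cnt_mono_one (n : ℕ) : cnt n (fun f => MonoP n f ∧ f n ≤ 1) = 1 := by
  have := cnt_mono n 0 (by omega)
  simpa using this

theorem cnt_cyc (n : ℕ) (hn : 1 ≤ n) :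
    cnt n (CycP n) + n = 1 + ∑ m ∈ Finset.Icc 1 n, catalan m := by
  have step : ∀ n, cnt (n + 1) (CycP (n + 1)) + 1 = cnt n (CycP n) + catalan (n + 1) := by
    intro n
    have a : cnt (n + 1) (CycP (n + 1)) = cnt n (CycP n) +
        cnt (n + 1) (fun f => MonoP (n + 1) f ∧ ¬ f (n + 1) ≤ 1) := by
      rw [cnt_add (Q := fun f => f (n + 1) = 1 ∧ CycP (n + 1) f)
        (R := fun f => MonoP (n + 1) f ∧ ¬ f (n + 1) ≤ 1), cnt_succ le_rfl (by omega)]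
      · congr 1
        exact cnt_congr fun g _ => cyc_upd_one
      · intro f hf
        have := Dn_pos hf (x := n + 1) (by omega)
        by_cases h : f (n + 1) = 1
        · simp [h]
        · rw [cyc_mono (by omega)]
          simp [h]
          omega
      · rintro f _ ⟨h1, _⟩ ⟨_, h2⟩
        omega
    have b := cnt_split (n + 1) (MonoP (n + 1)) (fun f => f (n + 1) ≤ 1)
    rw [cnt_mono_one, cnt_mono_all] at b
    omega
  have h0 : cnt 0 (CycP 0) = 1 := cnt_true_zero (fun x y h1 h2 h3 => by omega)
  induction n, hn using Nat.le_induction with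
  | base =>
    have := step 0
    rw [zero_add] at this
    simp only [Finset.Icc_self, Finset.sum_singleton]
    omega
  | succ n hn ih =>
    rw [Finset.sum_Icc_succ_top (by omega)]
    have := step n
    omega

theorem cnt_anti_ge (n : ℕ) : ∀ d j, 2 ≤ j → j + d = n + 1 →
    cnt n (fun f => AntiP n f ∧ j ≤ f n) + 1 = 2 ^ d := by
  induction n with
  | zero => intro d j h1 h2; omega
  | succ n ih =>
    intro d
    induction d with
    | zero =>
      intro j h1 h2
      rw [cnt_zero]
      · simp
      · rintro f hf ⟨_, h⟩
        have := Dn_le hf (n + 1)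
        omega
    | succ d ihd =>
      intro j h1 h2
      rw [cnt_add (Q := fun f => AntiP (n + 1) f ∧ j + 1 ≤ f (n + 1))
        (R := fun f => f (n + 1) = j ∧ AntiP (n + 1) f), cnt_succ (by omega) (by omega),
        cnt_add (n := n) (Q := fun f => AntiP n f ∧ j ≤ f n) (R := fun f => ¬ NC n f),
        cnt_const]
      · have a := ihd (j + 1) (by omega) (by omega)
        have b := ih d j h1 (by omega)
        rw [pow_succ]
        omega
      · intro g hg
        rw [anti_upd]
        constructor
        · rintro ⟨a, b⟩
          by_cases h : NC n g
          · exact Or.inl ⟨a, b h⟩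
          · exact Or.inr h
        · rintro (⟨a, b⟩ | h)
          · exact ⟨a, fun _ => b⟩
          · refine ⟨fun x y h1 h2 h3 h4 => ?_, fun h' => (h h').elim⟩
            exact (h ⟨x, h1, by omega, h4⟩).elim
      · rintro g hg ⟨_, h⟩ h'
        have := Dn_le hg n
        exact h' ⟨n, by omega, le_rfl, by omega⟩
      · intro f _
        constructor
        · rintro ⟨a, b⟩
          by_cases h : f (n + 1) = j
          · exact Or.inr ⟨h, a⟩
          · exact Or.inl ⟨a, by omega⟩
        · rintro (⟨a, b⟩ | ⟨a, b⟩)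
          · exact ⟨a, by omega⟩
          · exact ⟨b, by omega⟩
      · rintro f _ ⟨_, a⟩ ⟨b, _⟩
        omega

theorem cnt_anti (n : ℕ) : cnt n (AntiP n) + n = 2 ^ n := by
  induction n with
  | zero => rw [cnt_true_zero (fun x y h1 h2 h3 => by omega)]; simp
  | succ n ih =>
    rw [cnt_add (Q := fun f => AntiP (n + 1) f ∧ 2 ≤ f (n + 1))
        (R := fun f => f (n + 1) = 1 ∧ AntiP (n + 1) f), cnt_succ le_rfl (by omega)]
    · have a := cnt_anti_ge (n + 1) n 2 le_rfl (by omega)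
      have b : cnt n (fun g => AntiP (n + 1) (Function.update g (n + 1) 1)) = cnt n (AntiP n) := by
        apply cnt_congr
        intro g hg
        rw [anti_upd]
        constructor
        · exact fun h => h.1
        · refine fun h => ⟨h, ?_⟩
          rintro ⟨x, h1, h2, _⟩
          exact Dn_pos hg (by omega)
      rw [b, pow_succ]
      omega
    · intro f hf
      have := Dn_pos hf (x := n + 1) (by omega)
      by_cases h : f (n + 1) = 1
      · simp [h]
      · simp [h]
        omega
    · rintro f _ ⟨_, a⟩ ⟨b, _⟩
      omega

theorem mono_const {n : ℕ} {f : ℕ → ℕ} (h : MonoP n f) (h' : f n ≤ 1) : ¬ NC n f := by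
  rintro ⟨x, h1, h2, h3⟩
  have := mono_le h h1 h2 le_rfl
  omega

/-- Step-shaped maps ending at level `j`. -/
theorem cnt_step (n : ℕ) : ∀ d j, 2 ≤ j → j + d = n + 1 →
    cnt n (fun f => f n = j ∧ MonoP n f ∧ AntiP n f) = d := by
  induction n with
  | zero => intro d j h1 h2; omega
  | succ n ih =>
    intro d j h1 h2
    rcases d with _ | d
    · apply cnt_zero
      rintro f hf ⟨h, _⟩
      have := Dn_le hf (n + 1)
      omega
    · rw [cnt_succ (by omega) (by omega) (fun f => MonoP (n + 1) f ∧ AntiP (n + 1) f),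
        cnt_add (n := n) (Q := fun f => f n = j ∧ MonoP n f ∧ AntiP n f)
          (R := fun f => MonoP n f ∧ f n ≤ 1), cnt_mono_one, ih d j h1 (by omega)]
      · intro g hg
        rw [anti_upd, mono_upd hg]
        constructor
        · rintro ⟨⟨a, b⟩, c, e⟩
          by_cases h : g n ≤ 1
          · exact Or.inr ⟨a, h⟩
          · have h0 := Dn_le hg n
            have := e ⟨n, by omega, le_rfl, by omega⟩
            exact Or.inl ⟨by omega, a, c⟩
        · rintro (⟨a, b, c⟩ | ⟨a, b⟩)
          · exact ⟨⟨b, a.le⟩, c, fun _ => a.ge⟩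
          · have h := mono_const a b
            refine ⟨⟨a, by omega⟩, fun x y h1 h2 h3 h4 => ?_, fun h' => (h h').elim⟩
            exact (h ⟨x, h1, by omega, h4⟩).elim
      · rintro g _ ⟨a, _⟩ ⟨_, b⟩
        omega

theorem cnt_step_ge (n : ℕ) : ∀ d j, 2 ≤ j → j + d = n + 1 →
    2 * cnt n (fun f => j ≤ f n ∧ MonoP n f ∧ AntiP n f) = d * (d + 1) := by
  intro d
  induction d with
  | zero =>
    intro j h1 h2
    have : cnt n (fun f => j ≤ f n ∧ MonoP n f ∧ AntiP n f) = 0 := by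
      apply cnt_zero
      rintro f hf ⟨h, _⟩
      have := Dn_le hf n
      omega
    rw [this]
  | succ d ih =>
    intro j h1 h2
    rw [cnt_add (Q := fun f => f n = j ∧ MonoP n f ∧ AntiP n f)
      (R := fun f => j + 1 ≤ f n ∧ MonoP n f ∧ AntiP n f), cnt_step n (d + 1) j h1 h2, mul_add,
      ih (j + 1) (by omega) (by omega)]
    · ring
    · intro f _
      have : j ≤ f n ↔ f n = j ∨ j + 1 ≤ f n := by omega
      tauto
    · rintro f _ ⟨a, _⟩ ⟨b, _⟩
      omega

theorem cnt_inter (n : ℕ) :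
    6 * cnt n (fun f => CycP n f ∧ AntiP n f) + n = 6 + n ^ 3 := by
  induction n with
  | zero =>
    rw [cnt_true_zero]
    · simp
    · exact ⟨fun x y h1 h2 h3 => by omega, fun x y h1 h2 h3 => by omega⟩
  | succ n ih =>
    rw [cnt_add (Q := fun f => f (n + 1) = 1 ∧ CycP (n + 1) f ∧ AntiP (n + 1) f)
      (R := fun f => 2 ≤ f (n + 1) ∧ MonoP (n + 1) f ∧ AntiP (n + 1) f),
      cnt_succ le_rfl (by omega) (fun f => CycP (n + 1) f ∧ AntiP (n + 1) f)]
    · have a := cnt_step_ge (n + 1) n 2 le_rfl (by omega)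
      have b : cnt n (fun g => CycP (n + 1) (Function.update g (n + 1) 1) ∧
          AntiP (n + 1) (Function.update g (n + 1) 1)) =
          cnt n (fun f => CycP n f ∧ AntiP n f) := by
        apply cnt_congr
        intro g hg
        rw [anti_upd, cyc_upd_one]
        constructor
        · exact fun h => ⟨h.1, h.2.1⟩
        · refine fun h => ⟨h.1, h.2, ?_⟩
          rintro ⟨x, h1, h2, _⟩
          exact Dn_pos hg (by omega)
      rw [b]
      nlinarith
    · intro f hf
      have := Dn_pos hf (x := n + 1) (by omega)
      by_cases h : f (n + 1) = 1
      · simp [h]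
      · have h2 : 2 ≤ f (n + 1) := by omega
        rw [cyc_mono (by omega)]
        simp [h, h2]
    · rintro f _ ⟨a, _⟩ ⟨b, _⟩
      omega

theorem card_ordn (n : ℕ) (hn : 4 ≤ n) :
    ((ORDn n).ncard : ℤ) = 2 ^ n - ((n : ℤ) ^ 3 + 11 * n) / 6
      + ∑ m ∈ Finset.Icc 1 n, (catalan m : ℤ) := by
  have h0 : (ORDn n).ncard = cnt n (fun f => CycP n f ∨ AntiP n f) := by
    unfold cnt ORDn
    congr 1
    ext f
    apply and_congr_right
    intro hf
    rw [cyclic_iff (by omega) hf, anticyclic_iff (by omega) hf]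
  have h1 : cnt n (fun f => CycP n f ∨ AntiP n f) =
      cnt n (CycP n) + cnt n (fun f => AntiP n f ∧ ¬ CycP n f) := by
    apply cnt_add
    · intro f _; tauto
    · intro f _; tauto
  have h2 := cnt_split n (AntiP n) (CycP n)
  have h3 : cnt n (fun f => AntiP n f ∧ CycP n f) = cnt n (fun f => CycP n f ∧ AntiP n f) :=
    cnt_congr fun f _ => and_comm
  have h4 := cnt_cyc n (by omega)
  have h5 := cnt_anti n
  have h6 := cnt_inter n
  rw [h3] at h2
  rw [h0]
  have h7 : ∑ m ∈ Finset.Icc 1 n, (catalan m : ℤ) = ((∑ m ∈ Finset.Icc 1 n, catalan m : ℕ) : ℤ) := by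
    push_cast; rfl
  rw [h7]
  zify at h1 h2 h4 h5 h6
  push_cast at h4 ⊢
  omega

end ORDPaper
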